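/- arXiv:1708.03354 — 2 statements merged into one kernel-verified Lean document; each statement's English description precedes it below -/
import Mathlib

section
/- Let w > 0 be an even integer. Then for every z ∈ ℍ, (∂_w 𝓔_{w,0})(z) = 𝕃(z)·((w+1)!/(2πi)^{w+2})·(1/2)·Σ_{(m,n)∈ℤ²∖{(0,0)}} (mz+n)^{−(w+2)}; that is, ∂_w 𝓔_{w,0} = 𝕃·𝔾_{w+2}, where 𝔾_{w+2} is the holomorphic Eisenstein series of weight w+2 written as a lattice sum. -/
open Complex

/-- The holomorphic Wirtinger derivative `∂/∂z = ½(∂/∂x − i ∂/∂y)`. -/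
noncomputable def wderiv (f : ℂ → ℂ) (z : ℂ) : ℂ :=
  (1 / 2) * (fderiv ℝ f z 1 - Complex.I * fderiv ℝ f z Complex.I)

/-- The Maass-type raising operator `(∂_r f)(z) = (z − z̄)·(∂f/∂z)(z) + r·f(z)`. -/
noncomputable def dOp (r : ℤ) (f : ℂ → ℂ) (z : ℂ) : ℂ :=
  (z - (starRingEnd ℂ) z) * wderiv f z + (r : ℂ) * f z

/-- `𝕃(z) = πi(z − z̄) = −2π·Im z`. -/
noncomputable def Lfun (z : ℂ) : ℂ := (Real.pi : ℂ) * Complex.I * (z - (starRingEnd ℂ) z)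

/-- The summand `(mz+n)^{−(r+1)}·(mz̄+n)^{−(s+1)}` of the real analytic Eisenstein series. -/
noncomputable def eisSummand (r s : ℕ) (z : ℂ) (p : ℤ × ℤ) : ℂ :=
  ((p.1 : ℂ) * z + (p.2 : ℂ)) ^ (-((r : ℤ) + 1)) *
    ((p.1 : ℂ) * (starRingEnd ℂ) z + (p.2 : ℂ)) ^ (-((s : ℤ) + 1))

/-- The real analytic Eisenstein series
`𝓔_{r,s}(z) = (w!/(2πi)^{w+2})·(1/2)·𝕃(z)·Σ'_{(m,n)} (mz+n)^{−(r+1)}(mz̄+n)^{−(s+1)}`. -/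
noncomputable def Eis (r s : ℕ) (z : ℂ) : ℂ :=
  ((r + s).factorial : ℂ) / (2 * (Real.pi : ℂ) * Complex.I) ^ (r + s + 2) * (1 / 2) *
    Lfun z * ∑' p : {p : ℤ × ℤ // p ≠ 0}, eisSummand r s z p.1

open EisensteinSeries in
/-- A lower bound for `‖mz+n‖`, uniform in the region `|Re z| ≤ A`, `B ≤ Im z`. -/
lemma exists_mul_norm_le_norm_lattice (A : ℝ) {B : ℝ} (hB : 0 < B) :
    ∃ c : ℝ, 0 < c ∧ ∀ z : ℂ, |z.re| ≤ A → B ≤ z.im → ∀ p : ℤ × ℤ, p ≠ 0 →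
      c * ‖![p.1, p.2]‖ ≤ ‖(p.1 : ℂ) * z + (p.2 : ℂ)‖ := by
  refine ⟨r ⟨⟨A, B⟩, hB⟩, r_pos _, fun z hA hz p hp ↦ ?_⟩
  have hx : (![p.1, p.2] : Fin 2 → ℤ) ≠ 0 := fun h ↦
    hp (Prod.ext (congrFun h 0) (congrFun h 1))
  have h1 := r_mul_max_le (⟨z, hB.trans_le hz⟩ : UpperHalfPlane) hx
  have h2 := r_lower_bound_on_verticalStrip (⟨z, hB.trans_le hz⟩ : UpperHalfPlane) hB
    (A := A) ⟨hA, hz⟩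
  exact (mul_le_mul_of_nonneg_right h2 (norm_nonneg _)).trans h1

lemma one_le_norm_intPair {p : ℤ × ℤ} (hp : p ≠ 0) : 1 ≤ ‖![p.1, p.2]‖ := by
  rw [EisensteinSeries.norm_eq_max_natAbs]
  have : 1 ≤ max p.1.natAbs p.2.natAbs := by
    by_contra! h
    exact hp (Prod.ext (by simp; omega) (by simp; omega))
  exact_mod_cast this

lemma summable_norm_intPair_inv_pow {k : ℕ} (hk : 2 < k) :
    Summable fun p : {p : ℤ × ℤ // p ≠ 0} ↦ (‖![p.1.1, p.1.2]‖ ^ k)⁻¹ := by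
  have h := (finTwoArrowEquiv ℤ).symm.summable_iff.mpr
    (EisensteinSeries.summable_one_div_norm_rpow (k := k) (by exact_mod_cast hk))
  refine (h.subtype {p : ℤ × ℤ | p ≠ 0}).congr fun p ↦ ?_
  simp [Real.rpow_neg]

lemma lattice_ne_zero {z : ℂ} (hz : 0 < z.im) {p : ℤ × ℤ} (hp : p ≠ 0) :
    (p.1 : ℂ) * z + (p.2 : ℂ) ≠ 0 := by
  obtain ⟨c, hc, h⟩ := exists_mul_norm_le_norm_lattice |z.re| hz
  exact norm_pos_iff.mp <| (mul_pos hc (zero_lt_one.trans_le (one_le_norm_intPair hp))).trans_le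
    (h z le_rfl le_rfl p hp)

lemma lattice_conj (z : ℂ) (p : ℤ × ℤ) :
    (p.1 : ℂ) * (starRingEnd ℂ) z + (p.2 : ℂ) = (starRingEnd ℂ) ((p.1 : ℂ) * z + (p.2 : ℂ)) := by
  simp

lemma norm_eisSummand (r s : ℕ) (z : ℂ) (p : ℤ × ℤ) :
    ‖eisSummand r s z p‖ = (‖(p.1 : ℂ) * z + (p.2 : ℂ)‖ ^ (r + s + 2))⁻¹ := by
  rw [eisSummand, lattice_conj, norm_mul, norm_zpow, norm_zpow, RCLike.norm_conj,
    zpow_neg, zpow_neg, ← mul_inv]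
  norm_cast
  rw [← pow_add]
  congr 2
  ring

lemma summable_real_analytic_eisSummand {r s : ℕ} (hrs : 0 < r + s) {z : ℂ} (hz : 0 < z.im) :
    Summable fun p : {p : ℤ × ℤ // p ≠ 0} ↦ eisSummand r s z p.1 := by
  obtain ⟨c, hc, h⟩ := exists_mul_norm_le_norm_lattice |z.re| hz
  refine .of_norm_bounded ((summable_norm_intPair_inv_pow (k := r + s + 2) (by omega)).mul_left
    (c ^ (r + s + 2))⁻¹) fun p ↦ ?_
  have hN := one_le_norm_intPair p.2
  rw [norm_eisSummand, ← mul_inv, ← mul_pow]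
  gcongr
  exact h z le_rfl le_rfl p.1 p.2

/-- The real Fréchet derivative of `eisSummand`. -/
noncomputable def eisSummandFDeriv (r s : ℕ) (z : ℂ) (p : ℤ × ℤ) : ℂ →L[ℝ] ℂ :=
  (-((r : ℂ) + 1) * p.1 * eisSummand (r + 1) s z p) • ContinuousLinearMap.id ℝ ℂ +
    (-((s : ℂ) + 1) * p.1 * eisSummand r (s + 1) z p) • (conjCLE : ℂ →L[ℝ] ℂ)

lemma hasDerivAt_lattice_zpow (p : ℤ × ℤ) (k : ℤ) {u : ℂ} (hu : (p.1 : ℂ) * u + p.2 ≠ 0) :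
    HasDerivAt (fun u : ℂ ↦ ((p.1 : ℂ) * u + p.2) ^ k)
      (k * ((p.1 : ℂ) * u + p.2) ^ (k - 1) * p.1) u := by
  have h : HasDerivAt (fun u : ℂ ↦ (p.1 : ℂ) * u + p.2) p.1 u := by
    simpa using ((hasDerivAt_id u).const_mul (p.1 : ℂ)).add_const (p.2 : ℂ)
  exact (hasDerivAt_zpow k _ (Or.inl hu)).comp u h

lemma hasFDerivAt_eisSummand (r s : ℕ) {z : ℂ} (hz : 0 < z.im) {p : ℤ × ℤ} (hp : p ≠ 0) :
    HasFDerivAt (fun z ↦ eisSummand r s z p) (eisSummandFDeriv r s z p) z := by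
  have h0 := lattice_ne_zero hz hp
  have h0' : (p.1 : ℂ) * (starRingEnd ℂ) z + p.2 ≠ 0 := by
    rw [lattice_conj]; exact (map_ne_zero _).mpr h0
  have h1 := (hasDerivAt_lattice_zpow p (-((r : ℤ) + 1)) h0).hasFDerivAt.restrictScalars ℝ
  have h2 := ((hasDerivAt_lattice_zpow p (-((s : ℤ) + 1)) h0').hasFDerivAt.restrictScalars ℝ).comp
    z (conjCLE : ℂ →L[ℝ] ℂ).hasFDerivAt
  refine (h1.mul h2).congr_fderiv ?_
  ext v
  simp [eisSummandFDeriv, eisSummand]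
  ring_nf

lemma norm_eisSummandFDeriv_le (r s : ℕ) (z : ℂ) (p : ℤ × ℤ) :
    ‖eisSummandFDeriv r s z p‖ ≤
      (r + s + 2) * ‖![p.1, p.2]‖ * (‖(p.1 : ℂ) * z + (p.2 : ℂ)‖ ^ (r + s + 3))⁻¹ := by
  have hm : ‖(p.1 : ℂ)‖ ≤ ‖![p.1, p.2]‖ := by
    simpa using EisensteinSeries.abs_le_left_of_norm p.2 p.1
  have hn (t : ℕ) : ‖-((t : ℂ) + 1)‖ = t + 1 := by
    rw [norm_neg]; exact_mod_cast Complex.norm_natCast (t + 1)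
  set q := (‖(p.1 : ℂ) * z + (p.2 : ℂ)‖ ^ (r + s + 3))⁻¹ with hq
  have hq0 : 0 ≤ q := by positivity
  have e1 : ‖eisSummand (r + 1) s z p‖ = q := by
    rw [norm_eisSummand, hq]; ring_nf
  have e2 : ‖eisSummand r (s + 1) z p‖ = q := by
    rw [norm_eisSummand, hq]; ring_nf
  refine (norm_add_le _ _).trans ?_
  rw [norm_smul, norm_smul, ContinuousLinearMap.norm_id, conjCLE_norm]
  simp only [norm_mul, hn, e1, e2]
  calc _ = (r + s + 2) * ‖(p.1 : ℂ)‖ * q := by ring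
    _ ≤ _ := by gcongr

lemma hasFDerivAt_tsum_eisSummand {r s : ℕ} (hrs : 0 < r + s) {z : ℂ} (hz : 0 < z.im) :
    ∃ F : ℂ →L[ℝ] ℂ,
      HasSum (fun p : {p : ℤ × ℤ // p ≠ 0} ↦ eisSummandFDeriv r s z p.1) F ∧
      HasFDerivAt (fun z ↦ ∑' p : {p : ℤ × ℤ // p ≠ 0}, eisSummand r s z p.1) F z := by
  obtain ⟨c, hc, h⟩ := exists_mul_norm_le_norm_lattice (|z.re| + 1) (half_pos hz)
  let U : Set ℂ := re ⁻¹' Set.Ioo (-(|z.re| + 1)) (|z.re| + 1) ∩ im ⁻¹' Set.Ioi (z.im / 2)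
  have hU : IsOpen U := (isOpen_Ioo.preimage continuous_re).inter (isOpen_Ioi.preimage continuous_im)
  have hUc : Convex ℝ U := ((convex_Ioo _ _).linear_preimage reLm).inter
    ((convex_Ioi _).linear_preimage imLm)
  have hzU : z ∈ U := ⟨abs_lt.mp (lt_add_one _), half_lt_self hz⟩
  have hsum := (summable_norm_intPair_inv_pow (k := r + s + 2) (by omega)).mul_left
    ((r + s + 2) * (c ^ (r + s + 3))⁻¹)
  have hbound (p : {p : ℤ × ℤ // p ≠ 0}) (u : ℂ) (hu : u ∈ U) :
      ‖eisSummandFDeriv r s u p.1‖ ≤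
        (r + s + 2) * (c ^ (r + s + 3))⁻¹ * (‖![p.1.1, p.1.2]‖ ^ (r + s + 2))⁻¹ := by
    have hN := one_le_norm_intPair p.2
    calc _ ≤ _ := norm_eisSummandFDeriv_le r s u p.1
      _ ≤ (r + s + 2) * ‖![p.1.1, p.1.2]‖ * ((c * ‖![p.1.1, p.1.2]‖) ^ (r + s + 3))⁻¹ := by
        gcongr
        exact h u (abs_lt.mpr hu.1).le hu.2.le p.1 p.2
      _ = _ := by rw [mul_pow, pow_succ ‖![p.1.1, p.1.2]‖]; field_simp
  exact ⟨_, (Summable.of_norm_bounded hsum fun p ↦ hbound p z hzU).hasSum,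
    hasFDerivAt_tsum_of_isPreconnected hsum hU hUc.isPreconnected
      (fun p u hu ↦ hasFDerivAt_eisSummand r s ((half_pos hz).trans hu.2) p.2) hbound hzU
      (summable_real_analytic_eisSummand hrs hz) hzU⟩

lemma wderiv_eq_of_hasFDerivAt {f : ℂ → ℂ} {F : ℂ →L[ℝ] ℂ} {z : ℂ} (h : HasFDerivAt f F z) :
    wderiv f z = (1 / 2) * (F 1 - I * F I) := by
  rw [wderiv, h.fderiv]

lemma hasFDerivAt_Lfun (z : ℂ) : HasFDerivAt Lfun
    (((Real.pi : ℂ) * I) • (ContinuousLinearMap.id ℝ ℂ - (conjCLE : ℂ →L[ℝ] ℂ))) z :=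
  ((hasFDerivAt_id z).sub (conjCLE : ℂ →L[ℝ] ℂ).hasFDerivAt).const_mul _

lemma wderiv_Lfun_mul {f : ℂ → ℂ} {F : ℂ →L[ℝ] ℂ} {z : ℂ} (h : HasFDerivAt f F z) (K : ℂ) :
    wderiv (fun z ↦ K * Lfun z * f z) z =
      K * (Real.pi * I * f z + Lfun z * wderiv f z) := by
  have hmul : HasFDerivAt (fun z ↦ K * Lfun z * f z) _ z :=
    ((hasFDerivAt_Lfun z).const_mul K).mul h
  rw [wderiv_eq_of_hasFDerivAt h, wderiv_eq_of_hasFDerivAt hmul]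
  simp
  linear_combination (-K * f z * Real.pi * I) * I_mul_I

lemma hasSum_wderiv_tsum_eisSummand {r s : ℕ} (hrs : 0 < r + s) {z : ℂ} (hz : 0 < z.im) :
    HasSum (fun p : {p : ℤ × ℤ // p ≠ 0} ↦
        -((r : ℂ) + 1) * p.1.1 * eisSummand (r + 1) s z p.1)
      (wderiv (fun z ↦ ∑' p : {p : ℤ × ℤ // p ≠ 0}, eisSummand r s z p.1) z) := by
  obtain ⟨F, hF, hd⟩ := hasFDerivAt_tsum_eisSummand hrs hz
  rw [wderiv_eq_of_hasFDerivAt hd]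
  have h (v : ℂ) := hF.mapL (ContinuousLinearMap.apply ℝ ℂ v)
  refine (((h 1).sub ((h I).mul_left I)).mul_left (1 / 2)).congr_fun ?_
  intro p
  simp [eisSummandFDeriv]
  linear_combination (-((r : ℂ) + 1) * p.1.1 * eisSummand (r + 1) s z p.1 / 2 +
    ((s : ℂ) + 1) * p.1.1 * eisSummand r (s + 1) z p.1 / 2) * I_mul_I

/-- For `w > 0` even, `∂_w 𝓔_{w,0} = 𝕃·𝔾_{w+2}`, where
`𝔾_{w+2}(z) = ((w+1)!/(2πi)^{w+2})·(1/2)·Σ'_{(m,n)≠(0,0)} (mz+n)^{−(w+2)}` is the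
holomorphic Eisenstein series of weight `w+2` written as a lattice sum. -/
theorem dOp_eis_top (w : ℕ) (hw : 0 < w) (he : Even w) :
    ∀ z : ℂ, 0 < z.im →
      dOp (w : ℤ) (Eis w 0) z
        = Lfun z * (((w + 1).factorial : ℂ) / (2 * (Real.pi : ℂ) * Complex.I) ^ (w + 2)
            * (1 / 2) *
            ∑' p : {p : ℤ × ℤ // p ≠ 0},
              ((p.1.1 : ℂ) * z + (p.1.2 : ℂ)) ^ (-((w : ℤ) + 2))) := by
  intro z hz
  obtain ⟨F, -, hd⟩ := hasFDerivAt_tsum_eisSummand (r := w) (s := 0) (by omega) hz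
  have hterm (p : {p : ℤ × ℤ // p ≠ 0}) :
      ((w : ℂ) + 1) * eisSummand w 0 z p.1 + (z - (starRingEnd ℂ) z) *
        (-((w : ℂ) + 1) * p.1.1 * eisSummand (w + 1) 0 z p.1) =
      ((w : ℂ) + 1) * ((p.1.1 : ℂ) * z + (p.1.2 : ℂ)) ^ (-((w : ℤ) + 2)) := by
    have h0 := lattice_ne_zero hz p.2
    have h0' : (p.1.1 : ℂ) * (starRingEnd ℂ) z + p.1.2 ≠ 0 := by
      rw [lattice_conj]; exact (map_ne_zero _).mpr h0
    have e1 : -((w : ℤ) + 1) = -((w : ℤ) + 2) + 1 := by ring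
    have e2 : -(((w + 1 : ℕ) : ℤ) + 1) = -((w : ℤ) + 2) := by push_cast; ring
    simp only [eisSummand, e1, e2, zpow_add_one₀ h0, Nat.cast_zero, zero_add, zpow_neg_one]
    field_simp
    ring
  have hS := (summable_real_analytic_eisSummand (r := w) (s := 0) (by omega) hz).hasSum
  have hD := hasSum_wderiv_tsum_eisSummand (r := w) (s := 0) (by omega) hz
  have key := ((hS.mul_left ((w : ℂ) + 1)).add (hD.mul_left (z - (starRingEnd ℂ) z))).tsum_eq
  simp only [hterm, tsum_mul_left] at key
  have hE : Eis w 0 = fun z ↦ ((w.factorial : ℂ) / (2 * (Real.pi : ℂ) * I) ^ (w + 2) * (1 / 2)) *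
      Lfun z * ∑' p : {p : ℤ × ℤ // p ≠ 0}, eisSummand w 0 z p.1 := rfl
  rw [dOp, hE, wderiv_Lfun_mul hd, Nat.factorial_succ]
  push_cast
  simp only [Lfun] at *
  linear_combination (-(w.factorial : ℂ) / (2 * (Real.pi : ℂ) * I) ^ (w + 2) * (1 / 2) *
    (Real.pi * I * (z - (starRingEnd ℂ) z))) * key
end

section
/- Let r, s ≥ 0 be integers with w = r + s > 0 even. Then the real analytic Eisenstein series is an eigenfunction of the Laplace operator with eigenvalue −w: −(∂̄_{s−1}(∂_r 𝓔_{r,s})) + r(s−1)·𝓔_{r,s} = −w·𝓔_{r,s} as functions on ℍ. -/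
open Complex

/-- The anti-holomorphic Wirtinger derivative `∂/∂z̄ = ½(∂/∂x + i ∂/∂y)`. -/
noncomputable def wderivBar (f : ℂ → ℂ) (z : ℂ) : ℂ :=
  (1 / 2) * (fderiv ℝ f z 1 + Complex.I * fderiv ℝ f z Complex.I)

/-- The Maass-type lowering operator `(∂̄_s f)(z) = (z̄ − z)·(∂f/∂z̄)(z) + s·f(z)`. -/
noncomputable def dBarOp (s : ℤ) (f : ℂ → ℂ) (z : ℂ) : ℂ :=
  ((starRingEnd ℂ) z - z) * wderivBar f z + (s : ℂ) * f z

open scoped ComplexConjugate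

/-- The real-linear map `h ↦ α h + β h̄`, i.e. the differential with Wirtinger derivatives
`α` and `β`. -/
noncomputable def wirtingerForm (α β : ℂ) : ℂ →L[ℝ] ℂ :=
  α • ContinuousLinearMap.id ℝ ℂ + β • (conjCLE : ℂ →L[ℝ] ℂ)

lemma wirtingerForm_apply (α β h : ℂ) : wirtingerForm α β h = α * h + β * conj h := by
  simp [wirtingerForm]

lemma norm_wirtingerForm_le (α β : ℂ) : ‖wirtingerForm α β‖ ≤ ‖α‖ + ‖β‖ := by
  refine ContinuousLinearMap.opNorm_le_bound _ (by positivity) fun h ↦ ?_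
  rw [wirtingerForm_apply]
  refine (norm_add_le _ _).trans_eq ?_
  rw [norm_mul, norm_mul, norm_conj]
  ring

lemma HasSum.wirtingerForm {ι : Type*} {f g : ι → ℂ} {α β : ℂ} (hf : HasSum f α)
    (hg : HasSum g β) :
    HasSum (fun i ↦ wirtingerForm (f i) (g i)) (wirtingerForm α β) :=
  (hf.smul_const _).add (hg.smul_const _)

lemma HasFDerivAt.wderiv_eq {f : ℂ → ℂ} {z α β : ℂ}
    (h : HasFDerivAt f (wirtingerForm α β) z) : wderiv f z = α := by
  rw [wderiv, h.fderiv, wirtingerForm_apply, wirtingerForm_apply, map_one, conj_I]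
  linear_combination (-(1 / 2) * α + (1 / 2) * β) * I_mul_I

lemma HasFDerivAt.wderivBar_eq {f : ℂ → ℂ} {z α β : ℂ}
    (h : HasFDerivAt f (wirtingerForm α β) z) : wderivBar f z = β := by
  rw [wderivBar, h.fderiv, wirtingerForm_apply, wirtingerForm_apply, map_one, conj_I]
  linear_combination ((1 / 2) * α - (1 / 2) * β) * I_mul_I

lemma Filter.EventuallyEq.wderivBar_eq {f g : ℂ → ℂ} {z : ℂ} (h : f =ᶠ[nhds z] g) :
    wderivBar f z = wderivBar g z := by
  rw [wderivBar, wderivBar, h.fderiv_eq]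

lemma sub_conj_ne_zero {z : ℂ} (hz : 0 < z.im) : z - conj z ≠ 0 := by
  rw [sub_conj]
  simp [hz.ne']

lemma norm_sub_conj {z : ℂ} (hz : 0 < z.im) : ‖z - conj z‖ = 2 * z.im := by
  rw [sub_conj]
  simp [abs_of_pos hz]

lemma intCast_mul_add_ne_zero {z : ℂ} (hz : 0 < z.im) {p : ℤ × ℤ} (hp : p ≠ 0) :
    (p.1 : ℂ) * z + p.2 ≠ 0 := by
  intro h
  have him := congrArg im h
  have hre := congrArg re h
  simp only [add_im, mul_im, intCast_re, intCast_im, zero_mul, add_zero, zero_im, mul_eq_zero,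
    hz.ne', or_false, Int.cast_eq_zero] at him
  simp only [him, Int.cast_zero, zero_mul, zero_add, intCast_re, zero_re, Int.cast_eq_zero] at hre
  exact hp (Prod.ext him hre)

lemma conj_intCast_mul_add (z : ℂ) (p : ℤ × ℤ) :
    conj ((p.1 : ℂ) * z + p.2) = (p.1 : ℂ) * conj z + p.2 := by
  simp

/-- The term `(mz+n)^{-a} (mz̄+n)^{-b}` with integral exponents. -/
noncomputable def latticeTerm (a b : ℤ) (p : ℤ × ℤ) (z : ℂ) : ℂ :=
  ((p.1 : ℂ) * z + p.2) ^ (-a) * ((p.1 : ℂ) * conj z + p.2) ^ (-b)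

/-- The sum of `(mz+n)^{-a} (mz̄+n)^{-b}` over nonzero `(m, n)`. -/
noncomputable def latticeSum (a b : ℤ) (z : ℂ) : ℂ :=
  ∑' p : {p : ℤ × ℤ // p ≠ 0}, latticeTerm a b p z

lemma norm_latticeTerm {z : ℂ} (hz : 0 < z.im) (a b : ℤ) {p : ℤ × ℤ} (hp : p ≠ 0) :
    ‖latticeTerm a b p z‖ = ‖(p.1 : ℂ) * z + p.2‖ ^ (-(a + b)) := by
  rw [latticeTerm, ← conj_intCast_mul_add, norm_mul, norm_zpow, norm_zpow, norm_conj,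
    ← zpow_add₀ (norm_ne_zero_iff.mpr (intCast_mul_add_ne_zero hz hp)), neg_add]

lemma exists_summable_bound_on_strip (A : ℝ) {B : ℝ} (hB : 0 < B) {k : ℤ} (hk : 2 < k) :
    ∃ u : {p : ℤ × ℤ // p ≠ 0} → ℝ, Summable u ∧ ∀ (p : {p : ℤ × ℤ // p ≠ 0}) (z : ℂ),
      |z.re| ≤ A → B ≤ z.im → ‖(p.1.1 : ℂ) * z + p.1.2‖ ^ (-k) ≤ u p := by
  have hk' : (2 : ℝ) < k := by exact_mod_cast hk
  let e : {p : ℤ × ℤ // p ≠ 0} → (Fin 2 → ℤ) := fun p ↦ (finTwoArrowEquiv ℤ).symm p.1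
  have he : Function.Injective e :=
    (finTwoArrowEquiv ℤ).symm.injective.comp Subtype.val_injective
  refine ⟨fun p ↦ EisensteinSeries.r ⟨⟨A, B⟩, hB⟩ ^ (-k : ℝ) * ‖e p‖ ^ (-k : ℝ),
    ((EisensteinSeries.summable_one_div_norm_rpow hk').comp_injective he).mul_left _,
    fun p z hA hB' ↦ ?_⟩
  have h := EisensteinSeries.summand_bound_of_mem_verticalStrip (z := ⟨z, hB.trans_le hB'⟩)
    (k := k) (by linarith) (e p) hB ⟨hA, hB'⟩
  rw [← Int.cast_neg, Real.rpow_intCast] at h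
  simpa [e, finTwoArrowEquiv] using h

lemma summable_latticeTerm {z : ℂ} (hz : 0 < z.im) {a b : ℤ} (hab : 2 < a + b) :
    Summable fun p : {p : ℤ × ℤ // p ≠ 0} ↦ latticeTerm a b p z := by
  obtain ⟨u, hu, hub⟩ := exists_summable_bound_on_strip |z.re| hz hab
  refine hu.of_norm_bounded fun p ↦ ?_
  rw [norm_latticeTerm hz a b p.2]
  exact hub p z le_rfl le_rfl

lemma hasSum_latticeTerm {z : ℂ} (hz : 0 < z.im) {a b : ℤ} (hab : 2 < a + b) :
    HasSum (fun p : {p : ℤ × ℤ // p ≠ 0} ↦ latticeTerm a b p z) (latticeSum a b z) :=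
  (summable_latticeTerm hz hab).hasSum

lemma hasFDerivAt_latticeTerm {z : ℂ} (hz : 0 < z.im) (a b : ℤ) {p : ℤ × ℤ} (hp : p ≠ 0) :
    HasFDerivAt (latticeTerm a b p)
      (wirtingerForm
        (a * (latticeTerm (a + 1) (b - 1) p z - latticeTerm a b p z) / (z - conj z))
        (b * (latticeTerm (a - 1) (b + 1) p z - latticeTerm a b p z) / (conj z - z))) z := by
  have hA := intCast_mul_add_ne_zero hz hp
  have hB : (p.1 : ℂ) * conj z + p.2 ≠ 0 := by
    rw [← conj_intCast_mul_add]
    exact (map_ne_zero _).mpr hA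
  have hy := sub_conj_ne_zero hz
  have hy' : conj z - z ≠ 0 := by
    rw [← neg_sub]
    exact neg_ne_zero.mpr hy
  have dA : HasFDerivAt (fun z : ℂ ↦ (p.1 : ℂ) * z + p.2)
      ((p.1 : ℂ) • ContinuousLinearMap.id ℝ ℂ) z :=
    ((hasFDerivAt_id z).const_mul (p.1 : ℂ)).add_const _
  have dB : HasFDerivAt (fun z : ℂ ↦ (p.1 : ℂ) * conj z + p.2)
      ((p.1 : ℂ) • (conjCLE : ℂ →L[ℝ] ℂ)) z :=
    ((conjCLE : ℂ →L[ℝ] ℂ).hasFDerivAt.const_mul (p.1 : ℂ)).add_const _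
  have h := ((hasDerivAt_zpow (-a) _ (.inl hA)).comp_hasFDerivAt z dA).mul
    ((hasDerivAt_zpow (-b) _ (.inl hB)).comp_hasFDerivAt z dB)
  refine h.congr_fderiv (ContinuousLinearMap.ext fun v ↦ ?_)
  have e₁ : ((p.1 : ℂ) * z + p.2) ^ (-(a - 1)) =
      ((p.1 : ℂ) * z + p.2) ^ (-a) * ((p.1 : ℂ) * z + p.2) := by
    rw [← zpow_add_one₀ hA]; congr 1; ring
  have e₂ : ((p.1 : ℂ) * z + p.2) ^ (-(a + 1)) =
      ((p.1 : ℂ) * z + p.2) ^ (-a) * ((p.1 : ℂ) * z + p.2)⁻¹ := by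
    rw [← zpow_sub_one₀ hA]; congr 1; ring
  have e₃ : ((p.1 : ℂ) * conj z + p.2) ^ (-(b - 1)) =
      ((p.1 : ℂ) * conj z + p.2) ^ (-b) * ((p.1 : ℂ) * conj z + p.2) := by
    rw [← zpow_add_one₀ hB]; congr 1; ring
  have e₄ : ((p.1 : ℂ) * conj z + p.2) ^ (-(b + 1)) =
      ((p.1 : ℂ) * conj z + p.2) ^ (-b) * ((p.1 : ℂ) * conj z + p.2)⁻¹ := by
    rw [← zpow_sub_one₀ hB]; congr 1; ring
  simp only [wirtingerForm_apply, latticeTerm, e₁, e₂, e₃, e₄, zpow_sub_one₀ hA, zpow_sub_one₀ hB,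
    add_apply, smul_apply, smul_eq_mul, ContinuousLinearMap.id_apply,
    ContinuousLinearEquiv.coe_coe, conjCLE_apply, Function.comp_apply, Int.cast_neg]
  field_simp
  ring

lemma norm_wirtingerForm_latticeTerm_le {z : ℂ} (hz : 0 < z.im) (a b : ℤ) {p : ℤ × ℤ}
    (hp : p ≠ 0) :
    ‖wirtingerForm
        (a * (latticeTerm (a + 1) (b - 1) p z - latticeTerm a b p z) / (z - conj z))
        (b * (latticeTerm (a - 1) (b + 1) p z - latticeTerm a b p z) / (conj z - z))‖ ≤
      (|(a : ℝ)| + |(b : ℝ)|) / z.im * ‖(p.1 : ℂ) * z + p.2‖ ^ (-(a + b)) := by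
  have key (c : ℤ) {a' b' : ℤ} (h : a' + b' = a + b) :
      ‖(c : ℂ) * (latticeTerm a' b' p z - latticeTerm a b p z) / (z - conj z)‖ ≤
        |(c : ℝ)| / z.im * ‖(p.1 : ℂ) * z + p.2‖ ^ (-(a + b)) := by
    have hsub := norm_sub_le (latticeTerm a' b' p z) (latticeTerm a b p z)
    rw [norm_latticeTerm hz a' b' hp, norm_latticeTerm hz a b hp, h] at hsub
    rw [norm_div, norm_mul, norm_sub_conj hz, norm_intCast, div_mul_eq_mul_div,
      div_le_div_iff₀ (by positivity) hz]
    nlinarith [mul_le_mul_of_nonneg_left hsub (mul_nonneg (abs_nonneg (c : ℝ)) hz.le)]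
  refine (norm_wirtingerForm_le _ _).trans ?_
  have h₁ := key a (show (a + 1) + (b - 1) = a + b by ring)
  have h₂ := key b (show (a - 1) + (b + 1) = a + b by ring)
  rw [← neg_sub z, div_neg, norm_neg, add_div, add_mul]
  exact add_le_add h₁ h₂

lemma hasFDerivAt_latticeSum {z : ℂ} (hz : 0 < z.im) {a b : ℤ} (hab : 2 < a + b) :
    HasFDerivAt (latticeSum a b)
      (wirtingerForm
        (a * (latticeSum (a + 1) (b - 1) z - latticeSum a b z) / (z - conj z))
        (b * (latticeSum (a - 1) (b + 1) z - latticeSum a b z) / (conj z - z))) z := by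
  obtain ⟨u, hu, hub⟩ :=
    exists_summable_bound_on_strip (|z.re| + z.im / 2) (half_pos hz) hab
  have hball (x : ℂ) (hx : x ∈ Metric.ball z (z.im / 2)) :
      |x.re| ≤ |z.re| + z.im / 2 ∧ z.im / 2 ≤ x.im := by
    rw [Metric.mem_ball, dist_eq] at hx
    have hre := (abs_re_le_norm (x - z)).trans hx.le
    have him := (abs_im_le_norm (x - z)).trans hx.le
    rw [sub_re] at hre
    rw [sub_im] at him
    exact ⟨by linarith [abs_sub_abs_le_abs_sub x.re z.re], by linarith [neg_abs_le (x.im - z.im)]⟩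
  have hpos (x : ℂ) (hx : x ∈ Metric.ball z (z.im / 2)) : 0 < x.im :=
    (half_pos hz).trans_le (hball x hx).2
  have hsum := HasSum.wirtingerForm
    ((((hasSum_latticeTerm hz (a := a + 1) (b := b - 1) (by linarith)).sub
      (hasSum_latticeTerm hz hab)).mul_left (a : ℂ)).div_const (z - conj z))
    ((((hasSum_latticeTerm hz (a := a - 1) (b := b + 1) (by linarith)).sub
      (hasSum_latticeTerm hz hab)).mul_left (b : ℂ)).div_const (conj z - z))
  rw [← hsum.tsum_eq]
  refine hasFDerivAt_tsum_of_isPreconnected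
    (f' := fun (p : {p : ℤ × ℤ // p ≠ 0}) z ↦ wirtingerForm
      (a * (latticeTerm (a + 1) (b - 1) p z - latticeTerm a b p z) / (z - conj z))
      (b * (latticeTerm (a - 1) (b + 1) p z - latticeTerm a b p z) / (conj z - z)))
    (hu.mul_left ((|(a : ℝ)| + |(b : ℝ)|) / (z.im / 2))) Metric.isOpen_ball
    (convex_ball z _).isPreconnected
    (fun p x hx ↦ hasFDerivAt_latticeTerm (hpos x hx) a b p.2) (fun p x hx ↦ ?_)
    (Metric.mem_ball_self (half_pos hz)) (summable_latticeTerm hz hab)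
    (Metric.mem_ball_self (half_pos hz))
  refine (norm_wirtingerForm_latticeTerm_le (hpos x hx) a b p.2).trans ?_
  obtain ⟨hx₁, hx₂⟩ := hball x hx
  have := half_pos hz
  gcongr
  exact hub p x hx₁ hx₂

lemma hasFDerivAt_const_mul_sub_conj_mul_latticeSum {z : ℂ} (hz : 0 < z.im) {a b : ℤ}
    (hab : 2 < a + b) (c : ℂ) :
    HasFDerivAt (fun z ↦ c * ((z - conj z) * latticeSum a b z))
      (wirtingerForm
        (c * (a * latticeSum (a + 1) (b - 1) z + (1 - a) * latticeSum a b z))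
        (-c * (b * latticeSum (a - 1) (b + 1) z + (1 - b) * latticeSum a b z))) z := by
  have hy := sub_conj_ne_zero hz
  have d : HasFDerivAt (fun z : ℂ ↦ z - conj z)
      (ContinuousLinearMap.id ℝ ℂ - (conjCLE : ℂ →L[ℝ] ℂ)) z :=
    (hasFDerivAt_id z).sub (conjCLE : ℂ →L[ℝ] ℂ).hasFDerivAt
  refine ((d.mul (hasFDerivAt_latticeSum hz hab)).const_mul c).congr_fderiv
    (ContinuousLinearMap.ext fun v ↦ ?_)
  simp only [wirtingerForm_apply, add_apply, sub_apply, smul_apply, smul_eq_mul,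
    ContinuousLinearMap.id_apply, ContinuousLinearEquiv.coe_coe, conjCLE_apply]
  rw [← neg_sub z, div_neg]
  field_simp
  ring

lemma dOp_const_mul_sub_conj_mul_latticeSum {z : ℂ} (hz : 0 < z.im) {a b : ℤ}
    (hab : 2 < a + b) (c : ℂ) (k : ℤ) :
    dOp k (fun z ↦ c * ((z - conj z) * latticeSum a b z)) z =
      c * (z - conj z) *
        (a * latticeSum (a + 1) (b - 1) z + (k + 1 - a) * latticeSum a b z) := by
  rw [dOp, (hasFDerivAt_const_mul_sub_conj_mul_latticeSum hz hab c).wderiv_eq]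
  ring

lemma dBarOp_const_mul_sub_conj_mul_latticeSum {z : ℂ} (hz : 0 < z.im) {a b : ℤ}
    (hab : 2 < a + b) (c : ℂ) (k : ℤ) :
    dBarOp k (fun z ↦ c * ((z - conj z) * latticeSum a b z)) z =
      c * (z - conj z) *
        (b * latticeSum (a - 1) (b + 1) z + (k + 1 - b) * latticeSum a b z) := by
  rw [dBarOp, (hasFDerivAt_const_mul_sub_conj_mul_latticeSum hz hab c).wderivBar_eq]
  ring

lemma Filter.EventuallyEq.dBarOp_eq {f g : ℂ → ℂ} {z : ℂ} (h : f =ᶠ[nhds z] g) (k : ℤ) :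
    dBarOp k f z = dBarOp k g z := by
  rw [dBarOp, dBarOp, h.wderivBar_eq, h.eq_of_nhds]

lemma exists_Eis_eq (r s : ℕ) :
    ∃ c : ℂ, Eis r s = fun z ↦ c * ((z - conj z) * latticeSum (r + 1) (s + 1) z) := by
  refine ⟨((r + s).factorial : ℂ) / (2 * (Real.pi : ℂ) * I) ^ (r + s + 2) * (1 / 2) *
    ((Real.pi : ℂ) * I), funext fun z ↦ ?_⟩
  simp only [Eis, Lfun, latticeSum, latticeTerm, eisSummand]
  ring

/-- The real analytic Eisenstein series `𝓔_{r,s}` is an eigenfunction of the Laplace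
operator `Δ_{r,s} = −∂̄_{s−1}∘∂_r + r(s−1)` with eigenvalue `−w`, `w = r+s`. -/
theorem eis_laplace_eigenfunction (r s : ℕ) (hw : 0 < r + s) (he : Even (r + s)) :
    ∀ z : ℂ, 0 < z.im →
      -(dBarOp ((s : ℤ) - 1) (dOp (r : ℤ) (Eis r s)) z)
          + (((r : ℤ) * ((s : ℤ) - 1) : ℤ) : ℂ) * Eis r s z
        = -(((r : ℕ) + s : ℕ) : ℂ) * Eis r s z := by
  intro z hz
  have hrs : (2 : ℤ) < (r + 1) + (s + 1) := by lia
  obtain ⟨c, hc⟩ := exists_Eis_eq r s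
  have hd : dOp (r : ℤ) (Eis r s) =ᶠ[nhds z]
      fun z ↦ c * (r + 1) * ((z - conj z) * latticeSum (r + 2) s z) := by
    filter_upwards [(isOpen_lt continuous_const continuous_im).mem_nhds hz] with x hx
    rw [hc, dOp_const_mul_sub_conj_mul_latticeSum hx hrs]
    rw [show (r : ℤ) + 1 + 1 = r + 2 by ring, show (s : ℤ) + 1 - 1 = s by ring]
    push_cast
    ring
  rw [hd.dBarOp_eq, dBarOp_const_mul_sub_conj_mul_latticeSum hz (by lia), hc,
    show (r : ℤ) + 2 - 1 = r + 1 by ring]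
  push_cast
  ring
end
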